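/- Let k be a field, F a field generator of A = k[X,Y], and Δ(F,A) = [d₁,…,d_t] the multiset of dicritical degrees. Then F is a variable of A (i.e., A = k[F,G] for some G ∈ A) if and only if t = 1. -/

import Mathlib

section Valuations

open Polynomial IntermediateField

variable {K L : Type*} [Field K] [Field L] [Algebra K L] {g : L}

namespace SimpleTranscendental

lemma aeval_ne_zero (hg : Transcendental K g) {p : K[X]} (hp : p ≠ 0) :
    aeval g p ≠ 0 := fun h ↦ hp (transcendental_iff.mp hg p h)

lemma exists_isCoprime_div_eq (htop : K⟮g⟯ = ⊤) (hg : Transcendental K g) (x : L) :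
    ∃ f h : K[X], IsCoprime f h ∧ h ≠ 0 ∧ x = aeval g f / aeval g h := by
  have hx : x ∈ K⟮g⟯ := by simp [htop]
  obtain ⟨r, s, rfl⟩ := (mem_adjoin_simple_iff K x).mp hx
  by_cases hs : s = 0
  · exact ⟨0, 1, isCoprime_zero_left.mpr isUnit_one, one_ne_zero, by simp [hs]⟩
  obtain ⟨h, f, c, hrel, rfl, rfl⟩ := UniqueFactorizationMonoid.exists_reduced_factors s hs r
  have hc : c ≠ 0 := left_ne_zero_of_mul hs
  refine ⟨f, h, hrel.isCoprime.symm, right_ne_zero_of_mul hs, ?_⟩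
  rw [map_mul, map_mul, mul_div_mul_left _ _ (aeval_ne_zero hg hc)]

variable {R R' : ValuationSubring L}

lemma aeval_mem (hR : ∀ c : K, algebraMap K L c ∈ R) (hg : g ∈ R) (p : K[X]) :
    aeval g p ∈ R := by
  rw [aeval_eq_sum_range]
  refine sum_mem fun i _ ↦ ?_
  rw [Algebra.smul_def]
  exact mul_mem (hR _) (pow_mem hg i)

lemma inv_mem_or_inv_mem_of_isCoprime {x y a b : L} (ha : a ∈ R) (hb : b ∈ R)
    (h : a * x + b * y = 1) : x⁻¹ ∈ R ∨ y⁻¹ ∈ R := by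
  by_contra! hxy
  have hx : R.valuation x < 1 := (ValuationSubring.mem_nonunits_iff _).mp ((ValuationSubring.mem_nonunits_iff_or _).mpr (.inr hxy.1))
  have hy : R.valuation y < 1 := (ValuationSubring.mem_nonunits_iff _).mp ((ValuationSubring.mem_nonunits_iff_or _).mpr (.inr hxy.2))
  rw [← ValuationSubring.valuation_le_one_iff] at ha hb
  have := R.valuation.map_add_lt (x := a * x) (y := b * y) (g := 1)
    (by rw [map_mul]; exact (mul_le_of_le_one_left' ha).trans_lt hx)
    (by rw [map_mul]; exact (mul_le_of_le_one_left' hb).trans_lt hy)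
  rw [h, map_one] at this
  exact lt_irrefl _ this

lemma valuation_algebraMap_eq_one (hR : ∀ c : K, algebraMap K L c ∈ R) {c : K} (hc : c ≠ 0) :
    R.valuation (algebraMap K L c) = 1 := by
  refine le_antisymm ((ValuationSubring.valuation_le_one_iff ..).mpr (hR c)) ?_
  have h := (ValuationSubring.valuation_le_one_iff ..).mpr (hR c⁻¹)
  rwa [map_inv₀, map_inv₀, inv_le_one₀] at h
  rw [Valuation.pos_iff]
  simpa using hc

lemma div_mem_iff_natDegree_le (hR : ∀ c : K, algebraMap K L c ∈ R) (hg : g ∉ R)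
    {f h : K[X]} (hf : f ≠ 0) (hh : h ≠ 0) :
    aeval g f / aeval g h ∈ R ↔ f.natDegree ≤ h.natDegree := by
  have : R.valuation.IsTrivialOn K := ⟨fun c hc ↦ valuation_algebraMap_eq_one hR hc⟩
  have h1 : 1 < R.valuation g := by
    rwa [← ValuationSubring.valuation_le_one_iff, not_le] at hg
  rw [← ValuationSubring.valuation_le_one_iff, map_div₀,
    valuation_aeval_eq_valuation_X_pow_natDegree_of_one_lt_valuation_X _ h1 hf,
    valuation_aeval_eq_valuation_X_pow_natDegree_of_one_lt_valuation_X _ h1 hh,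
    div_le_one₀ (pow_pos (zero_lt_one.trans h1) _), pow_le_pow_iff_right₀ h1]

lemma eq_of_notMem (htop : K⟮g⟯ = ⊤) (ht : Transcendental K g)
    (hR : ∀ c : K, algebraMap K L c ∈ R) (hR' : ∀ c : K, algebraMap K L c ∈ R')
    (hg : g ∉ R) (hg' : g ∉ R') : R = R' := by
  ext x
  obtain ⟨f, h, -, hh, rfl⟩ := exists_isCoprime_div_eq htop ht x
  by_cases hf : f = 0
  · simp [hf]
  rw [div_mem_iff_natDegree_le hR hg hf hh, div_mem_iff_natDegree_le hR' hg' hf hh]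

lemma inv_mem_or_inv_mem_of_isCoprime_aeval (hR : ∀ c : K, algebraMap K L c ∈ R) (hg : g ∈ R)
    {p q : K[X]} (h : IsCoprime p q) : (aeval g p)⁻¹ ∈ R ∨ (aeval g q)⁻¹ ∈ R := by
  obtain ⟨a, b, hab⟩ := h
  refine inv_mem_or_inv_mem_of_isCoprime (aeval_mem hR hg a) (aeval_mem hR hg b) ?_
  rw [← map_mul, ← map_mul, ← map_add, hab, map_one]

lemma div_mem_iff_not_dvd (ht : Transcendental K g) (hR : ∀ c : K, algebraMap K L c ∈ R)
    (hg : g ∈ R) {π : K[X]} (hπ : Irreducible π) (hπR : (aeval g π)⁻¹ ∉ R)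
    {f h : K[X]} (hfh : IsCoprime f h) (hh : h ≠ 0) :
    aeval g f / aeval g h ∈ R ↔ ¬ π ∣ h := by
  have key {q : K[X]} (hq : ¬ π ∣ q) : (aeval g q)⁻¹ ∈ R :=
    (inv_mem_or_inv_mem_of_isCoprime_aeval hR hg
      (hπ.coprime_iff_not_dvd.mpr hq)).resolve_left hπR
  refine ⟨fun hmem hdvd ↦ hπR ?_, fun hdvd ↦ ?_⟩
  · have hf : ¬ π ∣ f := fun hf ↦ hπ.not_isUnit (hfh.isUnit_of_dvd' hf hdvd)
    have hf0 : f ≠ 0 := fun h0 ↦ hf (h0 ▸ dvd_zero π)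
    obtain ⟨c, rfl⟩ := hdvd
    have := mul_mem (aeval_mem hR hg c) (mul_mem (key hf) hmem)
    have hc : c ≠ 0 := right_ne_zero_of_mul hh
    have hf1 := aeval_ne_zero ht hf0
    have hc1 := aeval_ne_zero ht hc
    have hp1 := aeval_ne_zero ht hπ.ne_zero
    convert! this using 1
    rw [map_mul]
    field_simp
  · rw [div_eq_mul_inv]
    exact mul_mem (aeval_mem hR hg f) (key hdvd)

lemma eq_of_inv_aeval_notMem (htop : K⟮g⟯ = ⊤) (ht : Transcendental K g)
    (hR : ∀ c : K, algebraMap K L c ∈ R) (hR' : ∀ c : K, algebraMap K L c ∈ R')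
    (hg : g ∈ R) (hg' : g ∈ R') {π : K[X]} (hπ : Irreducible π)
    (hπR : (aeval g π)⁻¹ ∉ R) (hπR' : (aeval g π)⁻¹ ∉ R') : R = R' := by
  ext x
  obtain ⟨f, h, hfh, hh, rfl⟩ := exists_isCoprime_div_eq htop ht x
  rw [div_mem_iff_not_dvd ht hR hg hπ hπR hfh hh, div_mem_iff_not_dvd ht hR' hg' hπ hπR' hfh hh]

lemma exists_le_inv_notMem {C : Subring L} {x : L} (hx : x ∈ C) (hx0 : x ≠ 0) (hxi : x⁻¹ ∉ C) :
    ∃ R : ValuationSubring L, C ≤ R.toSubring ∧ x⁻¹ ∉ R := by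
  have hI : Ideal.span {(⟨x, hx⟩ : C)} ≠ ⊤ := by
    rw [Ne, Ideal.span_singleton_eq_top]
    rintro ⟨u, hu⟩
    refine hxi ?_
    have h1 : x * (↑(u⁻¹) : C) = 1 := by
      have := congrArg (Subtype.val) (u.mul_inv)
      rw [hu] at this
      exact this
    rw [inv_eq_of_mul_eq_one_right h1]
    exact Subtype.property _
  obtain ⟨R, hCR, hR⟩ := Ideal.image_subset_nonunits_valuationSubring _ hI
  refine ⟨R, hCR, ?_⟩
  have := hR ⟨⟨x, hx⟩, Ideal.mem_span_singleton_self _, rfl⟩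
  exact ((ValuationSubring.mem_nonunits_iff_or _).mp this).resolve_left hx0

lemma inv_aeval_notMem_adjoin (ht : Transcendental K g) {h : K[X]} (hh : h ≠ 0)
    (hu : ¬ IsUnit h) : (aeval g h)⁻¹ ∉ Algebra.adjoin K {g} := by
  rw [Algebra.adjoin_singleton_eq_range_aeval]
  rintro ⟨q, hq⟩
  refine hu (IsUnit.of_mul_eq_one q (transcendental_iff_injective.mp ht ?_))
  simp only [map_mul, map_one]
  erw [hq]
  exact mul_inv_cancel₀ (aeval_ne_zero ht hh)

lemma exists_mem_inv_aeval_notMem (ht : Transcendental K g) {h : K[X]} (hh : h ≠ 0)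
    (hu : ¬ IsUnit h) : ∃ R : ValuationSubring L, (∀ c : K, algebraMap K L c ∈ R) ∧ g ∈ R ∧
      (aeval g h)⁻¹ ∉ R := by
  obtain ⟨R, hR, hx⟩ := exists_le_inv_notMem (C := (Algebra.adjoin K {g}).toSubring)
    (x := aeval g h) (aeval_mem_adjoin_singleton K g) (aeval_ne_zero ht hh)
    (inv_aeval_notMem_adjoin ht hh hu)
  exact ⟨R, fun c ↦ hR (Subalgebra.algebraMap_mem _ c),
    hR (Algebra.self_mem_adjoin_singleton K g), hx⟩

lemma exists_mem_notMem (htop : K⟮g⟯ = ⊤) (ht : Transcendental K g) {x : L}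
    (hx : x ∉ Algebra.adjoin K {g}) :
    ∃ R : ValuationSubring L, (∀ c : K, algebraMap K L c ∈ R) ∧ g ∈ R ∧ x ∉ R := by
  obtain ⟨f, h, hfh, hh, rfl⟩ := exists_isCoprime_div_eq htop ht x
  have hu : ¬ IsUnit h := by
    intro hu
    obtain ⟨c, hc, rfl⟩ := Polynomial.isUnit_iff.mp hu
    refine hx ?_
    rw [aeval_C, div_eq_mul_inv, ← map_inv₀]
    exact mul_mem (aeval_mem_adjoin_singleton K g) (Subalgebra.algebraMap_mem _ _)
  obtain ⟨R, hR, hg, hhR⟩ := exists_mem_inv_aeval_notMem ht hh hu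
  refine ⟨R, hR, hg, fun hm ↦ hhR ?_⟩
  obtain ⟨a, b, hab⟩ := hfh
  have h0 := aeval_ne_zero ht hh
  have : (aeval g h)⁻¹ = aeval g a * (aeval g f / aeval g h) + aeval g b := by
    field_simp
    rw [← map_mul, ← map_mul, ← map_add, mul_comm h b, hab, map_one]
  rw [this]
  exact add_mem (mul_mem (aeval_mem hR hg a) hm) (aeval_mem hR hg b)

lemma exists_notMem (ht : Transcendental K g) :
    ∃ R : ValuationSubring L, (∀ c : K, algebraMap K L c ∈ R) ∧ g ∉ R := by
  have ht' : Transcendental K g⁻¹ := fun h ↦ ht (by simpa using h.inv)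
  obtain ⟨R, hR, -, h⟩ := exists_mem_inv_aeval_notMem ht' X_ne_zero not_isUnit_X
  exact ⟨R, hR, by simpa using h⟩

end SimpleTranscendental

end Valuations

section UniqueRing

open Polynomial IntermediateField SimpleTranscendental

variable {K L : Type*} [Field K] [Field L] [Algebra K L] {g : L}

namespace SimpleTranscendental

/-- `B` is a subring of `L` containing `K`, and `R₀` is the only valuation ring of `L / K` that
does not contain `B`. -/
structure HasUniquePole (K : Type*) {L : Type*} [Field K] [Field L] [Algebra K L]
    (B : Subring L) (R₀ : ValuationSubring L) : Prop where
  algebraMap_mem : ∀ c : K, algebraMap K L c ∈ B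
  algebraMap_mem_pole : ∀ c : K, algebraMap K L c ∈ R₀
  not_le : ¬ B ≤ R₀.toSubring
  le_of_ne : ∀ R : ValuationSubring L, (∀ c : K, algebraMap K L c ∈ R) → R ≠ R₀ → B ≤ R.toSubring

namespace HasUniquePole

variable {B : Subring L} {R₀ : ValuationSubring L}

lemma exists_of_notMem [IsIntegrallyClosedIn B L] (hB : HasUniquePole K B R₀) {x : L}
    (hx : x ∉ B) :
    ∃ R : ValuationSubring L, (∀ c : K, algebraMap K L c ∈ R) ∧ R ≠ R₀ ∧ x ∉ R := by
  obtain ⟨R, hBR, hxR⟩ := Subring.exists_le_valuationSubring_of_isIntegrallyClosedIn hx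
  exact ⟨R, fun c ↦ hBR (hB.algebraMap_mem c), fun h ↦ hB.not_le (h ▸ hBR), hxR⟩

lemma eq_adjoin_of_notMem [IsIntegrallyClosedIn B L] (hB : HasUniquePole K B R₀)
    (htop : K⟮g⟯ = ⊤) (ht : Transcendental K g) (hg : g ∉ R₀) :
    B = (Algebra.adjoin K {g}).toSubring := by
  apply le_antisymm
  · intro x hx
    by_contra hxg
    obtain ⟨R, hR, hgR, hxR⟩ := exists_mem_notMem htop ht hxg
    exact hxR (hB.le_of_ne R hR (fun h ↦ hg (h ▸ hgR)) hx)
  · have hgB : g ∈ B := by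
      by_contra hgB
      obtain ⟨R, hR, hne, hgR⟩ := hB.exists_of_notMem hgB
      exact hne (eq_of_notMem htop ht hR hB.algebraMap_mem_pole hgR hg)
    intro x hx
    induction hx using Algebra.adjoin_induction with
    | mem x hx => rwa [Set.mem_singleton_iff.mp hx]
    | algebraMap c => exact hB.algebraMap_mem c
    | add _ _ _ _ h1 h2 => exact add_mem h1 h2
    | mul _ _ _ _ h1 h2 => exact mul_mem h1 h2

lemma exists_irreducible (hB : HasUniquePole K B R₀) (htop : K⟮g⟯ = ⊤) (ht : Transcendental K g)
    (hg : g ∈ R₀) : ∃ π : K[X], Irreducible π ∧ (aeval g π)⁻¹ ∉ R₀ := by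
  obtain ⟨y, -, hy⟩ := Set.not_subset.mp hB.not_le
  obtain ⟨f, h, -, hh, rfl⟩ := exists_isCoprime_div_eq htop ht y
  have hhR : (aeval g h)⁻¹ ∉ R₀ := fun hm ↦ hy (by
    rw [div_eq_mul_inv]
    exact mul_mem (aeval_mem hB.algebraMap_mem_pole hg f) hm)
  clear hy
  induction h using WfDvdMonoid.induction_on_irreducible with
  | zero => exact absurd rfl hh
  | unit u hu =>
    obtain ⟨c, -, rfl⟩ := Polynomial.isUnit_iff.mp hu
    rw [aeval_C, ← map_inv₀] at hhR
    exact absurd (hB.algebraMap_mem_pole _) hhR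
  | mul a i ha hi ih =>
    by_cases hiR : (aeval g i)⁻¹ ∈ R₀
    · refine ih ha fun haR ↦ hhR ?_
      rw [map_mul, mul_inv]
      exact mul_mem hiR haR
    · exact ⟨i, hi, hiR⟩

variable {π : K[X]}

lemma div_mem [IsIntegrallyClosedIn B L] (hB : HasUniquePole K B R₀)
    (htop : K⟮g⟯ = ⊤) (ht : Transcendental K g) (hg : g ∈ R₀) (hπ : Irreducible π)
    (hπR : (aeval g π)⁻¹ ∉ R₀) {f : K[X]} (hf : f ≠ 0) (hfπ : f.natDegree ≤ π.natDegree) :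
    aeval g f / aeval g π ∈ B := by
  by_contra hm
  obtain ⟨R, hR, hne, hmR⟩ := hB.exists_of_notMem hm
  by_cases hgR : g ∈ R
  · refine hne (eq_of_inv_aeval_notMem htop ht hR hB.algebraMap_mem_pole hgR hg hπ ?_ hπR)
    intro h
    rw [div_eq_mul_inv] at hmR
    exact hmR (mul_mem (aeval_mem hR hgR f) h)
  · exact hmR ((div_mem_iff_natDegree_le hR hgR hf hπ.ne_zero).mpr hfπ)

lemma exists_eq_div_pow (hB : HasUniquePole K B R₀)
    (htop : K⟮g⟯ = ⊤) (ht : Transcendental K g) (hg : g ∈ R₀) (hπ : Irreducible π)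
    (hπR : (aeval g π)⁻¹ ∉ R₀) {a : L} (ha : a ∈ B) :
    ∃ (f : K[X]) (m : ℕ), IsCoprime f (π ^ m) ∧ a = aeval g f / aeval g π ^ m := by
  obtain ⟨f, h, hfh, hh, rfl⟩ := exists_isCoprime_div_eq htop ht a
  have key (ρ : K[X]) (hρ : Irreducible ρ) (hρh : ρ ∣ h) : π ∣ ρ := by
    obtain ⟨R, hR, hgR, hρR⟩ := exists_mem_inv_aeval_notMem ht hρ.ne_zero hρ.not_isUnit
    have haR := mt (div_mem_iff_not_dvd ht hR hgR hρ hρR hfh hh).mp (not_not.mpr hρh)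
    obtain rfl : R = R₀ := by
      by_contra hne
      exact haR (hB.le_of_ne R hR hne ha)
    by_contra hd
    exact (inv_mem_or_inv_mem_of_isCoprime_aeval hR hg (hπ.coprime_iff_not_dvd.mpr hd)).elim
      hπR hρR
  obtain ⟨c, hc, hcd⟩ := (FiniteMultiplicity.of_not_isUnit hπ.not_isUnit hh).exists_eq_pow_mul_and_not_dvd
  generalize multiplicity π h = m at hc
  have hcu : IsUnit c := by
    by_contra hcu
    obtain ⟨ρ, hρ, hρc⟩ := WfDvdMonoid.exists_irreducible_factor hcu
      (right_ne_zero_of_mul (hc ▸ hh))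
    exact hcd ((key ρ hρ (hc ▸ hρc.mul_left _)).trans hρc)
  obtain ⟨e, he, rfl⟩ := Polynomial.isUnit_iff.mp hcu
  have he0 := he.ne_zero
  refine ⟨C e⁻¹ * f, m, ?_, ?_⟩
  · rw [isCoprime_mul_unit_left_left (by simpa using he0)]
    exact hfh.of_isCoprime_of_dvd_right (hc ▸ dvd_mul_right _ _)
  · have h1 := aeval_ne_zero ht hπ.ne_zero
    have : algebraMap K L e ≠ 0 := by simpa using he0
    rw [hc]
    simp only [map_mul, map_pow, aeval_C, map_inv₀]
    field_simp

lemma notMem (hB : HasUniquePole K B R₀) (ht : Transcendental K g) (hg : g ∈ R₀) : g ∉ B := by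
  obtain ⟨R, hR, hgR⟩ := exists_notMem ht
  exact fun h ↦ hgR (hB.le_of_ne R hR (fun h ↦ hgR (h ▸ hg)) h)

lemma exists_eq_const_div_pow [IsIntegrallyClosedIn B L] (hB : HasUniquePole K B R₀)
    (htop : K⟮g⟯ = ⊤) (ht : Transcendental K g) (hg : g ∈ R₀) (hπ : Irreducible π)
    (hπR : (aeval g π)⁻¹ ∉ R₀) (hπB : aeval g π ∉ B) {a b : L} (ha : a ∈ B) (hb : b ∈ B)
    (hab : a * b = (aeval g π)⁻¹) :
    ∃ (c : K) (m : ℕ), c ≠ 0 ∧ a = algebraMap K L c / aeval g π ^ m := by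
  obtain ⟨f₁, m, hc₁, rfl⟩ := hB.exists_eq_div_pow htop ht hg hπ hπR ha
  obtain ⟨f₂, n, hc₂, rfl⟩ := hB.exists_eq_div_pow htop ht hg hπ hπR hb
  have h1 := aeval_ne_zero ht hπ.ne_zero
  have hpol : f₁ * (f₂ * π) = π ^ (m + n) := by
    apply transcendental_iff_injective.mp ht
    simp only [map_mul, map_pow, pow_add]
    field_simp at hab
    linear_combination hab
  obtain ⟨i, -, u, hu⟩ := (dvd_prime_pow hπ.prime _).mp (hpol ▸ dvd_mul_right f₁ _)
  have hu' : f₁ = π ^ i * (↑(u⁻¹) : K[X]) := by rw [← hu]; simp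
  obtain ⟨c, hc, hcu⟩ := Polynomial.isUnit_iff.mp (u⁻¹).isUnit
  have hc0 := hc.ne_zero
  have hcL : algebraMap K L c ≠ 0 := by simpa using hc0
  rw [← hcu] at hu'
  rcases Nat.eq_zero_or_pos i with rfl | hi
  · exact ⟨c, m, hc0, by rw [hu']; simp⟩
  exfalso
  obtain ⟨i, rfl⟩ := Nat.exists_eq_add_of_le' hi
  have hm : m = 0 := by
    by_contra hm
    refine hπ.not_isUnit (hc₁.isUnit_of_dvd' ?_ (dvd_pow_self π hm))
    exact hu' ▸ (dvd_pow_self π (Nat.succ_ne_zero i)).mul_right _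
  subst hm
  have hinv : (aeval g π)⁻¹ ∈ B := by
    rw [← hab]; exact mul_mem ha hb
  refine hπB ?_
  have : aeval g π = algebraMap K L c⁻¹ * (aeval g f₁ / aeval g π ^ 0) *
      (aeval g π)⁻¹ ^ i := by
    rw [hu']
    simp only [map_mul, map_pow, aeval_C, map_inv₀, inv_pow, Nat.succ_eq_add_one]
    field_simp
    ring
  rw [this]
  exact mul_mem (mul_mem (hB.algebraMap_mem _) ha) (pow_mem hinv i)

lemma natDegree_eq_one [IsIntegrallyClosedIn B L] [UniqueFactorizationMonoid B]
    (hB : HasUniquePole K B R₀)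
    (htop : K⟮g⟯ = ⊤) (ht : Transcendental K g) (hg : g ∈ R₀) (hπ : Irreducible π)
    (hπR : (aeval g π)⁻¹ ∉ R₀) : π.natDegree = 1 := by
  by_contra hd
  have hd1 : 1 ≤ π.natDegree := hπ.natDegree_pos
  obtain ⟨d, hd2⟩ : ∃ d, π.natDegree = d + 2 := ⟨π.natDegree - 2, by omega⟩
  have h1 := aeval_ne_zero ht hπ.ne_zero
  have hgB : g ∉ B := hB.notMem ht hg
  have hz : g / aeval g π ∈ B := by
    simpa using hB.div_mem htop ht hg hπ hπR (f := X) X_ne_zero (by simpa using hd1)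
  have hw : g ^ (d + 2) / aeval g π ∈ B := by
    simpa using hB.div_mem htop ht hg hπ hπR (f := X ^ (d + 2)) (pow_ne_zero _ X_ne_zero)
      (by simp [hd2])
  have hu : (aeval g π)⁻¹ ∈ B := by
    simpa using hB.div_mem htop ht hg hπ hπR (f := 1) one_ne_zero (by simp)
  have hπB : aeval g π ∉ B := fun h ↦ hgB (by
    have := mul_mem h hz
    rwa [mul_div_cancel₀ _ h1] at this)
  have hirr : Irreducible (⟨_, hu⟩ : B) := by
    refine ⟨fun h ↦ ?_, fun a b hab ↦ ?_⟩
    · obtain ⟨v, hv⟩ := h.exists_right_inv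
      have hv' : (aeval g π)⁻¹ * (v : L) = 1 := congrArg Subtype.val hv
      have : aeval g π = v := by field_simp at hv'; exact hv'.symm
      exact hπB (this ▸ v.2)
    · have hab' : (a : L) * b = (aeval g π)⁻¹ := (congrArg Subtype.val hab).symm
      obtain ⟨c, m, hc, ha⟩ := hB.exists_eq_const_div_pow htop ht hg hπ hπR hπB a.2 b.2 hab'
      obtain ⟨e, n, he, hb⟩ := hB.exists_eq_const_div_pow htop ht hg hπ hπR hπB b.2 a.2
        (by rw [mul_comm, hab'])
      have hpol : C (c * e) * π = π ^ (m + n) := by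
        apply transcendental_iff_injective.mp ht
        rw [ha, hb] at hab'
        simp only [map_mul, map_pow, pow_add, aeval_C]
        field_simp at hab'
        linear_combination hab'
      have hdeg := congrArg natDegree hpol
      rw [natDegree_C_mul (mul_ne_zero hc he), natDegree_pow] at hdeg
      have hmn : m + n = 1 := (Nat.eq_of_mul_eq_mul_right (by omega) (hdeg.symm.trans (one_mul _).symm))
      have hunit {a : B} {c : K} (hc : c ≠ 0) (ha : (a : L) = algebraMap K L c) : IsUnit a := by
        refine IsUnit.of_mul_eq_one ⟨_, hB.algebraMap_mem c⁻¹⟩ (Subtype.ext ?_)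
        change (a : L) * algebraMap K L c⁻¹ = 1
        rw [ha, ← map_mul, mul_inv_cancel₀ hc, map_one]
      rcases Nat.eq_zero_or_pos m with rfl | hm
      · exact .inl (hunit hc (by simpa using ha))
      · obtain rfl : n = 0 := by omega
        exact .inr (hunit he (by simpa using hb))
  have hprime := UniqueFactorizationMonoid.irreducible_iff_prime.mp hirr
  have hdvd : (⟨_, hu⟩ : B) ∣ ⟨_, hz⟩ ^ (d + 2) := by
    refine ⟨⟨_, hw⟩ * ⟨_, hu⟩ ^ d, Subtype.ext ?_⟩
    change (g / aeval g π) ^ (d + 2) =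
      (aeval g π)⁻¹ * (g ^ (d + 2) / aeval g π * (aeval g π)⁻¹ ^ d)
    rw [div_pow, inv_pow]
    field_simp
    ring
  obtain ⟨b, hb⟩ := hprime.dvd_of_dvd_pow hdvd
  have hb' : g / aeval g π = (aeval g π)⁻¹ * (b : L) := congrArg Subtype.val hb
  field_simp at hb'
  exact hgB (hb' ▸ b.2)

theorem exists_eq_adjoin [IsIntegrallyClosedIn B L] [UniqueFactorizationMonoid B]
    (hB : HasUniquePole K B R₀) (htop : K⟮g⟯ = ⊤) (ht : Transcendental K g) :
    ∃ t : L, B = (Algebra.adjoin K {t}).toSubring := by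
  by_cases hg : g ∈ R₀
  swap
  · exact ⟨g, hB.eq_adjoin_of_notMem htop ht hg⟩
  obtain ⟨π, hπ, hπR⟩ := hB.exists_irreducible htop ht hg
  obtain ⟨a, ha, b, rfl⟩ := Polynomial.natDegree_eq_one.mp (hB.natDegree_eq_one htop ht hg hπ hπR)
  have haL : algebraMap K L a ≠ 0 := by simpa using ha
  set t := (aeval g (C a * X + C b))⁻¹ with htdef
  have hgt : g = algebraMap K L a⁻¹ * (t⁻¹ - algebraMap K L b) := by
    rw [htdef, inv_inv]
    simp [haL]
  refine ⟨t, hB.eq_adjoin_of_notMem ?_ ?_ hπR⟩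
  · rw [eq_top_iff, ← htop, adjoin_simple_le_iff, hgt]
    exact mul_mem (IntermediateField.algebraMap_mem _ _)
      (sub_mem (inv_mem (mem_adjoin_simple_self K t)) (IntermediateField.algebraMap_mem _ _))
  · intro hta
    refine ht ?_
    rw [hgt]
    exact (isAlgebraic_algebraMap _).mul (hta.inv.sub (isAlgebraic_algebraMap _))

end HasUniquePole

end SimpleTranscendental

end UniqueRing

open MvPolynomial

open Polynomial.Bivariate in
lemma injective_aevalAeval {k E : Type*} [Field k] [CommRing E] [IsDomain E] [Algebra k E]
    {x y : E} (halg : Algebra.IsAlgebraic (Algebra.adjoin k (Set.range ![x, y])) E)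
    (htr : 2 ≤ Algebra.trdeg k E) :
    Function.Injective (Polynomial.aevalAeval x y : Polynomial (Polynomial k) →ₐ[k] E) := by
  have hb := Algebra.IsAlgebraic.isTranscendenceBasis_of_lift_le_trdeg_of_finite k ![x, y]
    (by simpa using htr)
  have hi : Function.Injective (MvPolynomial.aeval (R := k) ![x, y]) := hb.1
  let e : Polynomial (Polynomial k) →ₐ[k] MvPolynomial (Fin 2) k :=
    Polynomial.aevalAeval (MvPolynomial.X 0) (MvPolynomial.X 1)
  let e' : MvPolynomial (Fin 2) k →ₐ[k] Polynomial (Polynomial k) :=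
    MvPolynomial.aeval ![Polynomial.C Polynomial.X, Polynomial.X]
  have he : Function.Injective e := by
    have : e'.comp e = AlgHom.id _ _ := by
      apply Polynomial.algHom_ext'
      · ext; simp [e, e']
      · simp [e, e']
    exact Function.LeftInverse.injective (g := e') (fun q => DFunLike.congr_fun this q)
  have hcomp : (Polynomial.aevalAeval x y : Polynomial (Polynomial k) →ₐ[k] E)
      = (MvPolynomial.aeval (R := k) ![x, y]).comp e := by
    apply Polynomial.algHom_ext'
    · ext; simp [e]
    · simp [e]
  rw [hcomp]
  exact hi.comp he

/-- `t` is a coordinate of the generic fibre of `F`: every polynomial lies in `k(F)[t]`. -/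
def IsGenericCoordinate {k : Type*} [Field k] (F t : MvPolynomial (Fin 2) k) : Prop :=
  ∀ a : MvPolynomial (Fin 2) k, ∃ (s : Polynomial k) (Q : Polynomial (Polynomial k)),
    Polynomial.aeval F s ≠ 0 ∧ Polynomial.aeval F s * a = Polynomial.aevalAeval F t Q

namespace IsGenericCoordinate

variable {k : Type*} [Field k] {F t : MvPolynomial (Fin 2) k}

lemma of_X (h : ∀ i, ∃ (s : Polynomial k) (Q : Polynomial (Polynomial k)),
    Polynomial.aeval F s ≠ 0 ∧ Polynomial.aeval F s * X i = Polynomial.aevalAeval F t Q) :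
    IsGenericCoordinate F t := by
  have hmul : ∀ a b : MvPolynomial (Fin 2) k,
      (∃ (s : Polynomial k) (Q : Polynomial (Polynomial k)),
        Polynomial.aeval F s ≠ 0 ∧ Polynomial.aeval F s * a = Polynomial.aevalAeval F t Q) →
      (∃ (s : Polynomial k) (Q : Polynomial (Polynomial k)),
        Polynomial.aeval F s ≠ 0 ∧ Polynomial.aeval F s * b = Polynomial.aevalAeval F t Q) →
      (∃ (s : Polynomial k) (Q : Polynomial (Polynomial k)),
        Polynomial.aeval F s ≠ 0 ∧ Polynomial.aeval F s * (a * b)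
          = Polynomial.aevalAeval F t Q) := by
    rintro a b ⟨s, Q, hs, hQ⟩ ⟨s', Q', hs', hQ'⟩
    refine ⟨s * s', Q * Q', by rw [map_mul]; exact mul_ne_zero hs hs', ?_⟩
    rw [map_mul, map_mul, ← hQ, ← hQ']
    ring
  intro a
  induction a using MvPolynomial.induction_on with
  | C c => exact ⟨1, Polynomial.C (Polynomial.C c), by simp, by
      rw [Polynomial.aevalAeval_C]; simp [MvPolynomial.algebraMap_eq]⟩
  | add a b ha hb =>
    obtain ⟨s, Q, hs, hQ⟩ := ha
    obtain ⟨s', Q', hs', hQ'⟩ := hb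
    refine ⟨s * s', Polynomial.C s' * Q + Polynomial.C s * Q',
      by rw [map_mul]; exact mul_ne_zero hs hs', ?_⟩
    rw [map_mul, map_add, map_mul, map_mul, ← hQ, ← hQ', Polynomial.aevalAeval_C,
      Polynomial.aevalAeval_C]
    ring
  | mul_X a i ha => exact hmul _ _ ha (h i)

lemma injective (h : IsGenericCoordinate F t) :
    Function.Injective
      (Polynomial.aevalAeval F t : Polynomial (Polynomial k) →ₐ[k] MvPolynomial (Fin 2) k) := by
  apply injective_aevalAeval
  · constructor
    intro a
    obtain ⟨s, Q, hs, hQ⟩ := h a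
    have hF : F ∈ Algebra.adjoin k (Set.range ![F, t]) := Algebra.subset_adjoin ⟨0, rfl⟩
    have ht : t ∈ Algebra.adjoin k (Set.range ![F, t]) := Algebra.subset_adjoin ⟨1, rfl⟩
    have hmem : ∀ P : Polynomial (Polynomial k),
        Polynomial.aevalAeval F t P ∈ Algebra.adjoin k (Set.range ![F, t]) := by
      intro P
      have : (Polynomial.aevalAeval F t :
          Polynomial (Polynomial k) →ₐ[k] MvPolynomial (Fin 2) k) =
          (Algebra.adjoin k (Set.range ![F, t])).val.comp
            (Polynomial.aevalAeval ⟨F, hF⟩ ⟨t, ht⟩) := by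
        apply Polynomial.algHom_ext'
        · ext; simp
        · simp
      rw [this]
      exact Subtype.property _
    have hQ' := hmem Q
    have hs' := hmem (Polynomial.C s)
    rw [Polynomial.aevalAeval_C] at hs'
    refine ⟨Polynomial.C ⟨_, hs'⟩ * Polynomial.X - Polynomial.C ⟨_, hQ'⟩, ?_, ?_⟩
    · intro h0
      have := congrArg (fun p => ((Polynomial.coeff p 1 :
        Algebra.adjoin k (Set.range ![F, t])) : MvPolynomial (Fin 2) k)) h0
      simp [Polynomial.coeff_C] at this
      exact hs this
    · simp only [map_sub, map_mul, Polynomial.aeval_C, Polynomial.aeval_X]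
      exact sub_eq_zero.mpr hQ
  · rw [MvPolynomial.trdeg_of_isDomain]
    simp

lemma aeval_injective (h : IsGenericCoordinate F t) :
    Function.Injective (Polynomial.aeval (R := k) F) := by
  intro p q hpq
  apply Polynomial.C_injective
  apply h.injective
  rw [Polynomial.aevalAeval_C, Polynomial.aevalAeval_C, hpq]

end IsGenericCoordinate

lemma exists_aeval_eq_of_mul_aeval_eq {k : Type*} [Field k] {F q : MvPolynomial (Fin 2) k}
    (hF : Function.Injective (Polynomial.aeval (R := k) F)) {s w : Polynomial k} (hs : s ≠ 0)
    (h : Polynomial.aeval F s * q = Polynomial.aeval F w) :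
    ∃ r : Polynomial k, q = Polynomial.aeval F r := by
  classical
  obtain ⟨s', hs'⟩ := EuclideanDomain.gcd_dvd_left s w
  obtain ⟨w', hw'⟩ := EuclideanDomain.gcd_dvd_right s w
  have hd : EuclideanDomain.gcd s w ≠ 0 := fun h0 => hs (by rw [hs', h0, zero_mul])
  have hcop : IsCoprime s' w' := by
    have := EuclideanDomain.gcd_eq_gcd_ab s w
    refine ⟨EuclideanDomain.gcdA s w, EuclideanDomain.gcdB s w, ?_⟩
    apply mul_left_cancel₀ hd
    calc _ = (EuclideanDomain.gcd s w * s') * EuclideanDomain.gcdA s w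
          + (EuclideanDomain.gcd s w * w') * EuclideanDomain.gcdB s w := by ring
      _ = _ := by rw [← hs', ← hw', ← this, mul_one]
  have hd' : Polynomial.aeval F (EuclideanDomain.gcd s w) ≠ 0 := by
    rw [Ne, ← map_zero (Polynomial.aeval F (R := k))]; exact fun h0 => hd (hF h0)
  have h' : Polynomial.aeval F s' * q = Polynomial.aeval F w' := by
    apply mul_left_cancel₀ hd'
    rw [← mul_assoc, ← map_mul, ← map_mul, ← hs', ← hw', h]
  obtain ⟨u, v, huv⟩ := hcop
  have hu : IsUnit (Polynomial.aeval F s') := by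
    refine IsUnit.of_mul_eq_one (Polynomial.aeval F u + Polynomial.aeval F v * q) ?_
    have := congrArg (Polynomial.aeval F) huv
    simp only [map_add, map_mul, map_one] at this
    rw [← this, ← h']; ring
  obtain ⟨c, hc, hc'⟩ := (MvPolynomial.isUnit_iff_eq_C_of_isReduced).1 hu
  have hc0 := hc.ne_zero
  refine ⟨Polynomial.C c⁻¹ * w', ?_⟩
  rw [map_mul, ← h', hc', Polynomial.aeval_C, MvPolynomial.algebraMap_eq, ← mul_assoc, ← C_mul,
    inv_mul_cancel₀ hc0, C_1, one_mul]

namespace IsGenericCoordinate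

variable {k : Type*} [Field k] {F t : MvPolynomial (Fin 2) k}

lemma ne_zero_of_aeval {s : Polynomial k} (h : Polynomial.aeval F s ≠ 0) : s ≠ 0 := by
  rintro rfl; simp at h

lemma prime_aeval (h : IsGenericCoordinate F t) {p : Polynomial k} (hp : Irreducible p) :
    Prime (Polynomial.aeval F p) := by
  rw [← irreducible_iff_prime, irreducible_iff]
  refine ⟨?_, ?_⟩
  · intro hu
    obtain ⟨c, hc, hc'⟩ := (MvPolynomial.isUnit_iff_eq_C_of_isReduced).1 hu
    have : p = Polynomial.C c := h.aeval_injective (by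
      rw [hc', Polynomial.aeval_C, MvPolynomial.algebraMap_eq])
    exact hp.not_isUnit (this ▸ Polynomial.isUnit_C.mpr hc)
  · intro q₁ q₂ hq
    obtain ⟨s₁, Q₁, hs₁, hQ₁⟩ := h q₁
    obtain ⟨s₂, Q₂, hs₂, hQ₂⟩ := h q₂
    have hQ : Q₁ * Q₂ = Polynomial.C (s₁ * s₂ * p) := by
      apply h.injective
      rw [map_mul, ← hQ₁, ← hQ₂, Polynomial.aevalAeval_C, map_mul, map_mul, hq]
      ring
    have hne : Q₁ * Q₂ ≠ 0 := by
      rw [hQ, Ne, Polynomial.C_eq_zero]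
      exact mul_ne_zero (mul_ne_zero (ne_zero_of_aeval hs₁) (ne_zero_of_aeval hs₂)) hp.ne_zero
    have hdeg : Q₁.natDegree + Q₂.natDegree = 0 := by
      rw [← Polynomial.natDegree_mul (left_ne_zero_of_mul hne) (right_ne_zero_of_mul hne), hQ,
        Polynomial.natDegree_C]
    rw [Polynomial.eq_C_of_natDegree_eq_zero (p := Q₁) (by omega), Polynomial.aevalAeval_C] at hQ₁
    rw [Polynomial.eq_C_of_natDegree_eq_zero (p := Q₂) (by omega), Polynomial.aevalAeval_C] at hQ₂
    obtain ⟨r₁, rfl⟩ :=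
      exists_aeval_eq_of_mul_aeval_eq h.aeval_injective (ne_zero_of_aeval hs₁) hQ₁
    obtain ⟨r₂, rfl⟩ :=
      exists_aeval_eq_of_mul_aeval_eq h.aeval_injective (ne_zero_of_aeval hs₂) hQ₂
    have : p = r₁ * r₂ := h.aeval_injective (by rw [hq, map_mul])
    exact (hp.isUnit_or_isUnit this).imp (fun hu => hu.map _) (fun hu => hu.map _)

end IsGenericCoordinate

lemma totalDegree_aeval_eq {k : Type*} [Field k] {F : MvPolynomial (Fin 2) k}
    (hF : 0 < F.totalDegree) {w : Polynomial k} (hw : w ≠ 0) :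
    (Polynomial.aeval F w).totalDegree = w.natDegree * F.totalDegree := by
  have hle : ∀ v : Polynomial k,
      (Polynomial.aeval F v).totalDegree ≤ v.natDegree * F.totalDegree := by
    intro v
    rw [Polynomial.aeval_eq_sum_range]
    refine (totalDegree_finsetSum _ _).trans (Finset.sup_le fun i hi => ?_)
    refine (totalDegree_smul_le _ _).trans ((totalDegree_pow _ _).trans ?_)
    exact Nat.mul_le_mul_right _ (Nat.lt_succ_iff.mp (Finset.mem_range.mp hi))
  have hF0 : F ≠ 0 := by rintro rfl; simp at hF
  have hpow : ∀ n, (F ^ n).totalDegree = n * F.totalDegree := by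
    intro n
    induction n with
    | zero => simp
    | succ n ih =>
      rw [pow_succ, totalDegree_mul_of_isDomain (pow_ne_zero _ hF0) hF0, ih]; ring
  have hlead : (Polynomial.aeval F (Polynomial.C w.leadingCoeff *
      Polynomial.X ^ w.natDegree)).totalDegree = w.natDegree * F.totalDegree := by
    have hlc : w.leadingCoeff ≠ 0 := Polynomial.leadingCoeff_ne_zero.mpr hw
    rw [map_mul, Polynomial.aeval_C, map_pow, Polynomial.aeval_X, MvPolynomial.algebraMap_eq,
      totalDegree_mul_of_isDomain (by simpa using hlc) (pow_ne_zero _ hF0), hpow, totalDegree_C,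
      zero_add]
  rcases Nat.eq_zero_or_pos w.natDegree with h0 | hpos
  · have := hle w
    rw [h0] at this ⊢
    omega
  · conv_lhs => rw [← w.eraseLead_add_C_mul_X_pow]
    rw [map_add, totalDegree_add_eq_right_of_totalDegree_lt, hlead]
    rw [hlead]
    refine (hle _).trans_lt (Nat.mul_lt_mul_of_pos_right ?_ hF)
    have := w.eraseLead_natDegree_le
    omega

section Descent

variable {k K : Type*} [Field k] [Field K] [Algebra k K]

/-- Apply a linear form to every coefficient of a polynomial. -/
noncomputable def coeffwise (φ : K →ₗ[k] k) :
    MvPolynomial (Fin 2) K →+ MvPolynomial (Fin 2) k where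
  toFun x := AddMonoidAlgebra.map φ.toAddMonoidHom x
  map_zero' := by ext m; simp
  map_add' x y := by ext m; simp

lemma coeff_coeffwise (φ : K →ₗ[k] k) (x : MvPolynomial (Fin 2) K) (m) :
    coeff m (coeffwise φ x) = φ (coeff m x) := rfl

lemma coeffwise_map_mul (φ : K →ₗ[k] k) (a : MvPolynomial (Fin 2) k)
    (x : MvPolynomial (Fin 2) K) :
    coeffwise φ (MvPolynomial.map (algebraMap k K) a * x) = a * coeffwise φ x := by
  ext m
  simp only [coeff_coeffwise, coeff_mul, coeff_map, map_sum]
  refine Finset.sum_congr rfl fun i _ => ?_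
  rw [← Algebra.smul_def, map_smul, smul_eq_mul]

lemma coeffwise_aeval (φ : K →ₗ[k] k) (F : MvPolynomial (Fin 2) k) (q : Polynomial K) :
    coeffwise φ (Polynomial.aeval (MvPolynomial.map (algebraMap k K) F) q) =
      Polynomial.aeval F (∑ i ∈ Finset.range (q.natDegree + 1),
        Polynomial.monomial i (φ (q.coeff i))) := by
  rw [Polynomial.aeval_eq_sum_range, map_sum, map_sum]
  refine Finset.sum_congr rfl fun i _ => ?_
  rw [Polynomial.aeval_monomial, MvPolynomial.algebraMap_eq, MvPolynomial.smul_eq_C_mul, mul_comm,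
    ← map_pow, coeffwise_map_mul, mul_comm]
  congr 1
  ext m
  simp only [coeff_coeffwise, coeff_C]
  split_ifs <;> simp

lemma aeval_map_map (F : MvPolynomial (Fin 2) k) (s : Polynomial k) :
    Polynomial.aeval (MvPolynomial.map (algebraMap k K) F) (s.map (algebraMap k K)) =
      MvPolynomial.map (algebraMap k K) (Polynomial.aeval F s) := by
  induction s using Polynomial.induction_on' with
  | add p q hp hq => simp only [Polynomial.map_add, map_add, hp, hq]
  | monomial n a => simp [Polynomial.aeval_monomial, MvPolynomial.algebraMap_eq]

/-- If `t` is congruent to a constant modulo `F - l`, with `l` a root of `p`, then it is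
congruent modulo `p(F)` to a polynomial in `F` over the ground field. -/
lemma exists_eq_aeval_add_mul {F t : MvPolynomial (Fin 2) k} {p : Polynomial k}
    (hp : Irreducible p) {l c : K} (hl : Polynomial.aeval l p = 0)
    (h : MvPolynomial.map (algebraMap k K) F - C l ∣ MvPolynomial.map (algebraMap k K) t - C c) :
    ∃ (r : Polynomial k) (b : MvPolynomial (Fin 2) k),
      t = Polynomial.aeval F r + Polynomial.aeval F p * b := by
  obtain ⟨a, ha⟩ := h
  obtain ⟨φ, hφ⟩ : ∃ φ : K →ₗ[k] k, φ 1 = 1 := by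
    obtain ⟨φ, hφ⟩ := LinearMap.exists_leftInverse_of_injective (Algebra.linearMap k K)
      (LinearMap.ker_eq_bot.mpr (algebraMap k K).injective)
    exact ⟨φ, by simpa using LinearMap.congr_fun hφ 1⟩
  set F' := MvPolynomial.map (algebraMap k K) F
  set p' := p.map (algebraMap k K) with hp'
  set q := p' /ₘ (Polynomial.X - Polynomial.C l) with hq
  have hpq : (Polynomial.X - Polynomial.C l) * q = p' := by
    rw [hq, Polynomial.mul_divByMonic_eq_iff_isRoot, Polynomial.IsRoot.def, hp',
      Polynomial.eval_map_algebraMap, hl]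
  have hp0 : p ≠ 0 := hp.ne_zero
  have hp'0 : p' ≠ 0 := (Polynomial.map_ne_zero_iff (algebraMap k K).injective).mpr hp0
  have hdeg : q.natDegree + 1 = p.natDegree := by
    have hq0 : q ≠ 0 := by rintro h0; rw [h0, mul_zero] at hpq; exact hp'0 hpq.symm
    rw [← Polynomial.natDegree_map (algebraMap k K) (p := p), ← hp', ← hpq,
      Polynomial.natDegree_mul (Polynomial.X_sub_C_ne_zero l) hq0, Polynomial.natDegree_X_sub_C,
      add_comm]
  have hlead : q.coeff q.natDegree = algebraMap k K p.leadingCoeff := by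
    have := congrArg Polynomial.leadingCoeff hpq
    rw [Polynomial.leadingCoeff_mul, Polynomial.leadingCoeff_X_sub_C, one_mul, hp',
      Polynomial.leadingCoeff_map] at this
    exact this
  set w := ∑ i ∈ Finset.range (q.natDegree + 1), Polynomial.monomial i (φ (q.coeff i)) with hw
  have hwcoeff : w.coeff q.natDegree = p.leadingCoeff := by
    rw [hw, Polynomial.finsetSum_coeff, Finset.sum_eq_single q.natDegree]
    · rw [Polynomial.coeff_monomial, if_pos rfl, hlead, Algebra.algebraMap_eq_smul_one, map_smul,
        hφ, smul_eq_mul, mul_one]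
    · intro i _ hi
      rw [Polynomial.coeff_monomial, if_neg hi]
    · simp
  have hw0 : w ≠ 0 := by
    intro h0
    rw [h0, Polynomial.coeff_zero] at hwcoeff
    exact hp0 (Polynomial.leadingCoeff_eq_zero.mp hwcoeff.symm)
  have hwdeg : w.natDegree < p.natDegree := by
    rw [← hdeg, Nat.lt_succ_iff]
    refine Polynomial.natDegree_sum_le_of_forall_le _ _ fun i hi => ?_
    exact (Polynomial.natDegree_monomial_le _).trans (Nat.lt_succ_iff.mp (Finset.mem_range.mp hi))
  have hcop : IsCoprime p w := by
    refine (hp.coprime_iff_not_dvd).mpr fun hdvd => ?_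
    exact absurd (Polynomial.natDegree_le_of_dvd hdvd hw0) (not_le.mpr hwdeg)
  obtain ⟨v, u, huv⟩ := hcop
  have key : MvPolynomial.map (algebraMap k K) t * Polynomial.aeval F' q
      - Polynomial.aeval F' (Polynomial.C c * q)
      = MvPolynomial.map (algebraMap k K) (Polynomial.aeval F p) * a := by
    rw [← aeval_map_map, ← hp', ← hpq]
    simp only [map_mul, map_sub, Polynomial.aeval_X, Polynomial.aeval_C, MvPolynomial.algebraMap_eq]
    linear_combination Polynomial.aeval F' q * ha
  have key' := congrArg (coeffwise φ) key
  rw [map_sub, coeffwise_map_mul, coeffwise_map_mul, coeffwise_aeval, coeffwise_aeval, ← hw] at key'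
  set w' := ∑ i ∈ Finset.range ((Polynomial.C c * q).natDegree + 1),
    Polynomial.monomial i (φ ((Polynomial.C c * q).coeff i))
  have huv' := congrArg (Polynomial.aeval F) huv
  simp only [map_add, map_mul, map_one] at huv'
  refine ⟨u * w', Polynomial.aeval F v * t + Polynomial.aeval F u * coeffwise φ a, ?_⟩
  rw [map_mul]
  linear_combination (- t) * huv' + Polynomial.aeval F u * key'

end Descent

namespace IsGenericCoordinate

variable {k : Type*} [Field k] {F t : MvPolynomial (Fin 2) k}

lemma baseChange (K : Type*) [Field K] [Algebra k K] (h : IsGenericCoordinate F t) :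
    IsGenericCoordinate (MvPolynomial.map (algebraMap k K) F)
      (MvPolynomial.map (algebraMap k K) t) := by
  apply of_X
  intro i
  obtain ⟨s, Q, hs, hQ⟩ := h (X i)
  refine ⟨s.map (algebraMap k K), Q.map (Polynomial.mapRingHom (algebraMap k K)), ?_, ?_⟩
  · rw [aeval_map_map]
    exact (map_ne_zero_iff _ (MvPolynomial.map_injective _ (algebraMap k K).injective)).mpr hs
  · rw [aeval_map_map, ← MvPolynomial.map_X (algebraMap k K) i, ← map_mul, hQ]
    clear hQ hs
    induction Q using Polynomial.induction_on' with
    | add p q hp hq => simp only [Polynomial.map_add, map_add, hp, hq]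
    | monomial n a =>
      rw [Polynomial.map_monomial, ← Polynomial.C_mul_X_pow_eq_monomial,
        ← Polynomial.C_mul_X_pow_eq_monomial]
      simp only [map_mul, map_pow, Polynomial.aevalAeval_C, Polynomial.aevalAeval_Y,
        Polynomial.coe_mapRingHom, aeval_map_map]

lemma of_eq_aeval_add_mul (h : IsGenericCoordinate F t) {r p : Polynomial k}
    {b : MvPolynomial (Fin 2) k} (hb : t = Polynomial.aeval F r + Polynomial.aeval F p * b) :
    IsGenericCoordinate F b := by
  intro a
  obtain ⟨s, Q, hs, hQ⟩ := h a
  refine ⟨s, Polynomial.aevalAeval (Polynomial.C Polynomial.X)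
    (Polynomial.C r + Polynomial.C p * Polynomial.X) Q, hs, ?_⟩
  rw [hQ]
  have : (Polynomial.aevalAeval F t : Polynomial (Polynomial k) →ₐ[k] MvPolynomial (Fin 2) k)
      = (Polynomial.aevalAeval F b).comp (Polynomial.aevalAeval (Polynomial.C Polynomial.X)
        (Polynomial.C r + Polynomial.C p * Polynomial.X)) := by
    apply Polynomial.algHom_ext'
    · ext; simp
    · simp only [AlgHom.comp_apply, Polynomial.aevalAeval_Y, map_add, map_mul,
        Polynomial.aevalAeval_C]
      exact hb
  rw [this]; rfl

lemma totalDegree_pos (h : IsGenericCoordinate F t) : 0 < F.totalDegree := by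
  rw [Nat.pos_iff_ne_zero, Ne, totalDegree_eq_zero_iff_eq_C]
  intro h0
  have : (Polynomial.X : Polynomial k) = Polynomial.C (F.coeff 0) := h.aeval_injective (by
    rw [Polynomial.aeval_C, Polynomial.aeval_X, MvPolynomial.algebraMap_eq]; exact h0)
  exact Polynomial.X_ne_C _ this

/-- Reducing `t` modulo `p(F)` to a polynomial in `F` lowers the degree. -/
lemma exists_totalDegree_lt (h : IsGenericCoordinate F t) {r p : Polynomial k}
    (hp : Irreducible p) {b : MvPolynomial (Fin 2) k}
    (hb : t = Polynomial.aeval F r + Polynomial.aeval F p * b) :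
    ∃ b', IsGenericCoordinate F b' ∧ b'.totalDegree < t.totalDegree := by
  set b' := Polynomial.aeval F (r / p) + b
  have hb' : t = Polynomial.aeval F (r % p) + Polynomial.aeval F p * b' := by
    rw [hb]
    conv_lhs => rw [← EuclideanDomain.div_add_mod r p]
    simp only [map_add, map_mul, b']; ring
  have hg := h.of_eq_aeval_add_mul hb'
  refine ⟨b', hg, ?_⟩
  clear_value b'
  have hFpos := h.totalDegree_pos
  have hb0 : b' ≠ 0 := by
    intro h0
    rw [h0] at hg
    have : (Polynomial.X : Polynomial (Polynomial k)) = 0 := hg.injective (by simp)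
    exact Polynomial.X_ne_zero this
  have hp0 : Polynomial.aeval F p ≠ 0 := (h.prime_aeval hp).ne_zero
  have hppos : 0 < p.natDegree := hp.natDegree_pos
  have hpb : (Polynomial.aeval F p * b').totalDegree
      = p.natDegree * F.totalDegree + b'.totalDegree := by
    rw [totalDegree_mul_of_isDomain hp0 hb0, totalDegree_aeval_eq hFpos hp.ne_zero]
  have hpos := Nat.mul_pos hppos hFpos
  have hr : (Polynomial.aeval F (r % p)).totalDegree < p.natDegree * F.totalDegree := by
    by_cases hr0 : r % p = 0
    · rw [hr0, map_zero, totalDegree_zero]; exact hpos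
    · rw [totalDegree_aeval_eq hFpos hr0]
      refine Nat.mul_lt_mul_of_pos_right ?_ hFpos
      exact Polynomial.natDegree_mod_lt r (by omega)
  rw [hb', totalDegree_add_eq_right_of_totalDegree_lt (by omega), hpb]
  omega

lemma exists_dvd_sub_C {K : Type*} [Field K] [IsAlgClosed K] {π x : MvPolynomial (Fin 2) K}
    (hπ : Prime π) {P : Polynomial K} (hP : P ≠ 0) (h : π ∣ Polynomial.aeval x P) :
    ∃ c, π ∣ x - C c := by
  rw [(IsAlgClosed.splits P).eq_prod_roots, map_mul] at h
  rcases hπ.dvd_or_dvd h with h | h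
  · exfalso
    rw [Polynomial.aeval_C] at h
    refine hπ.not_isUnit (isUnit_of_dvd_unit h (IsUnit.map _ ?_))
    exact (isUnit_iff_ne_zero.mpr (Polynomial.leadingCoeff_ne_zero.mpr hP))
  · rw [map_multiset_prod, Multiset.map_map] at h
    obtain ⟨c, -, hc⟩ := Prime.exists_mem_multiset_map_dvd hπ h
    exact ⟨c, by simpa [MvPolynomial.algebraMap_eq] using hc⟩

lemma exists_eq_of_dvd (h : IsGenericCoordinate F t) {p : Polynomial k} (hp : Irreducible p)
    {P : Polynomial (Polynomial k)} (hP : ¬ Polynomial.C p ∣ P)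
    (hdvd : Polynomial.aeval F p ∣ Polynomial.aevalAeval F t P) :
    ∃ (r : Polynomial k) (b : MvPolynomial (Fin 2) k),
      t = Polynomial.aeval F r + Polynomial.aeval F p * b := by
  let K := AlgebraicClosure k
  obtain ⟨l, hl⟩ := IsAlgClosed.exists_aeval_eq_zero K p
    (Polynomial.degree_pos_of_irreducible hp).ne'
  have hK := h.baseChange K
  set F' := MvPolynomial.map (algebraMap k K) F with hF'
  set t' := MvPolynomial.map (algebraMap k K) t with ht'
  have hprime : Prime (F' - C l) := by
    have := hK.prime_aeval (Polynomial.irreducible_X_sub_C l)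
    simpa [MvPolynomial.algebraMap_eq] using this
  have hred : ∀ s : Polynomial k, F' - C l ∣
      MvPolynomial.map (algebraMap k K) (Polynomial.aeval F s) - C (Polynomial.aeval l s) := by
    intro s
    have := Polynomial.sub_dvd_eval_sub F' (C l)
      ((s.map (algebraMap k K)).map (C : K →+* MvPolynomial (Fin 2) K))
    rw [← aeval_map_map, Polynomial.aeval_def,
      Polynomial.eval₂_eq_eval_map, MvPolynomial.algebraMap_eq, ← hF']
    rwa [Polynomial.eval_map_apply, Polynomial.eval_map_algebraMap] at this
  set P' : Polynomial K := P.map (Polynomial.aeval (R := k) l).toRingHom with hP'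
  have hP'0 : P' ≠ 0 := by
    intro h0
    refine hP ((Polynomial.C_dvd_iff_dvd_coeff _ _).mpr fun i => ?_)
    have hi : Polynomial.aeval l (P.coeff i) = 0 := by
      have := congrArg (fun q => Polynomial.coeff q i) h0
      simpa [hP'] using this
    by_contra hnd
    obtain ⟨u, v, huv⟩ := (hp.coprime_iff_not_dvd).mpr hnd
    have := congrArg (Polynomial.aeval l) huv
    simp [hl, hi] at this
  have hcong : F' - C l ∣ MvPolynomial.map (algebraMap k K) (Polynomial.aevalAeval F t P)
      - Polynomial.aeval t' P' := by
    rw [hP']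
    clear hP'0 hP' hdvd hP P'
    induction P using Polynomial.induction_on' with
    | add p q hp hq =>
      simp only [Polynomial.map_add, map_add]
      rw [add_sub_add_comm]
      exact dvd_add hp hq
    | monomial n a =>
      rw [← Polynomial.C_mul_X_pow_eq_monomial]
      simp only [map_mul, map_pow, Polynomial.aevalAeval_C, Polynomial.aevalAeval_Y,
        Polynomial.map_mul, Polynomial.map_C, Polynomial.map_pow, Polynomial.map_X,
        Polynomial.aeval_C, Polynomial.aeval_X, MvPolynomial.algebraMap_eq]
      rw [← ht', ← sub_mul]
      exact Dvd.dvd.mul_right (hred a) _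
  have hd : F' - C l ∣ Polynomial.aeval t' P' := by
    have h1 : F' - C l ∣ MvPolynomial.map (algebraMap k K) (Polynomial.aeval F p) := by
      simpa [hl] using hred p
    have h2 := h1.trans (map_dvd (MvPolynomial.map (algebraMap k K)) hdvd)
    exact (dvd_sub_right h2).mp hcong
  obtain ⟨c, hc⟩ := exists_dvd_sub_C hprime hP'0 hd
  exact exists_eq_aeval_add_mul hp hl hc

/-- A polynomial whose generic fibre is an affine line is a variable. -/
theorem exists_adjoin_eq_top (h : IsGenericCoordinate F t) :
    ∃ G : MvPolynomial (Fin 2) k, Algebra.adjoin k {F, G} = ⊤ := by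
  classical
  have hex : ∃ n, ∃ t, IsGenericCoordinate F t ∧ t.totalDegree = n := ⟨_, t, h, rfl⟩
  obtain ⟨G, hG, hGdeg⟩ := Nat.find_spec hex
  have hdvd : ∀ p : Polynomial k, Irreducible p → ∀ P : Polynomial (Polynomial k),
      Polynomial.aeval F p ∣ Polynomial.aevalAeval F G P → Polynomial.C p ∣ P := by
    intro p hp P hdvd
    by_contra hP
    obtain ⟨r, b, hb⟩ := hG.exists_eq_of_dvd hp hP hdvd
    obtain ⟨b', hb', hlt⟩ := hG.exists_totalDegree_lt hp hb
    exact Nat.find_min hex (hGdeg ▸ hlt) ⟨b', hb', rfl⟩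
  refine ⟨G, eq_top_iff.mpr fun a _ => ?_⟩
  have hG' : G ∈ Algebra.adjoin k ({F, G} : Set (MvPolynomial (Fin 2) k)) := Algebra.subset_adjoin (by simp)
  obtain ⟨s, Q, hs, hQ⟩ := hG a
  have hrange : ∃ P : Polynomial (Polynomial k), a = Polynomial.aevalAeval F G P := by
    induction s using WfDvdMonoid.induction_on_irreducible generalizing Q with
    | zero => simp at hs
    | unit u hu =>
      obtain ⟨v, hv⟩ := hu.exists_left_inv
      refine ⟨Polynomial.C v * Q, ?_⟩
      rw [map_mul, ← hQ, Polynomial.aevalAeval_C, ← mul_assoc, ← map_mul, hv, map_one, one_mul]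
    | mul s p hs0 hp ih =>
      rw [map_mul] at hs hQ
      obtain ⟨Q', rfl⟩ := hdvd p hp Q ⟨_, by rw [← hQ, mul_assoc]⟩
      refine ih Q' (right_ne_zero_of_mul hs) ?_
      apply mul_left_cancel₀ (left_ne_zero_of_mul hs)
      rw [← mul_assoc, hQ, map_mul, Polynomial.aevalAeval_C]
  obtain ⟨P, rfl⟩ := hrange
  have hmem : ∀ p : Polynomial k, Polynomial.aeval F p ∈ Algebra.adjoin k {F, G} := fun p =>
    Algebra.adjoin_mono (Set.singleton_subset_iff.mpr (Set.mem_insert F {G}))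
      (Polynomial.aeval_mem_adjoin_singleton k F)
  clear hQ
  induction P using Polynomial.induction_on' with
  | add p q hp hq =>
    rw [map_add]
    exact add_mem (hp trivial) (hq trivial)
  | monomial n a =>
    rw [← Polynomial.C_mul_X_pow_eq_monomial, map_mul, map_pow, Polynomial.aevalAeval_C,
      Polynomial.aevalAeval_Y]
    exact mul_mem (hmem a) (pow_mem hG' n)

end IsGenericCoordinate

section FieldGenerator

open IntermediateField

variable {k L : Type*} [Field k] [Field L] [Algebra k L]

lemma IntermediateField.isAlgebraic_algebraAdjoin_of_adjoin_eq_top {S : Set L}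
    (h : IntermediateField.adjoin k S = ⊤) : Algebra.IsAlgebraic (Algebra.adjoin k S) L := by
  refine ⟨fun x ↦ ?_⟩
  have hx : x ∈ IntermediateField.adjoin k S := by simp [h]
  obtain ⟨r, hr, s, hs, rfl⟩ := mem_adjoin_iff_div.mp hx
  rw [div_eq_mul_inv]
  exact (isAlgebraic_algebraMap (⟨r, hr⟩ : Algebra.adjoin k S)).mul
    (isAlgebraic_algebraMap (⟨s, hs⟩ : Algebra.adjoin k S)).inv

lemma algebraicIndependent_of_adjoin_eq_top {x y : L} (htr : Algebra.trdeg k L = 2)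
    (h : IntermediateField.adjoin k {x, y} = ⊤) : AlgebraicIndependent k ![x, y] := by
  have : Algebra.IsAlgebraic (Algebra.adjoin k (Set.range ![x, y])) L :=
    isAlgebraic_algebraAdjoin_of_adjoin_eq_top (by rwa [Matrix.range_cons, Matrix.range_cons, Matrix.range_empty, Set.union_empty,
      Set.singleton_union])
  exact (Algebra.IsAlgebraic.isTranscendenceBasis_of_lift_le_trdeg_of_finite k ![x, y]
    (by simp [htr])).1

open IntermediateField.algebraAdjoinAdjoin in
lemma AlgebraicIndependent.transcendental_adjoin_simple {x y : L}
    (h : AlgebraicIndependent k ![x, y]) : Transcendental k⟮x⟯ y := by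
  have := h.transcendental_adjoin (s := {0}) (i := 1) (by simp)
  rw [Set.image_singleton] at this
  exact fun hy ↦ this ((IsFractionRing.isAlgebraic_iff (Algebra.adjoin k {x}) k⟮x⟯ L).mpr hy)

lemma adjoin_simple_adjoin_simple_eq_top {x y : L}
    (h : IntermediateField.adjoin k {x, y} = ⊤) : (k⟮x⟯)⟮y⟯ = ⊤ := by
  rw [← restrictScalars_eq_top_iff (K := k), adjoin_adjoin_left, ← h]
  rfl

lemma trdeg_eq_two [Algebra (MvPolynomial (Fin 2) k) L] [IsFractionRing (MvPolynomial (Fin 2) k) L]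
    [IsScalarTower k (MvPolynomial (Fin 2) k) L] : Algebra.trdeg k L = 2 := by
  have := IsLocalization.isAlgebraic L (nonZeroDivisors (MvPolynomial (Fin 2) k))
  have : FaithfulSMul (MvPolynomial (Fin 2) k) L :=
    (faithfulSMul_iff_algebraMap_injective _ _).mpr (IsFractionRing.injective _ L)
  have h := lift_trdeg_add_eq k (MvPolynomial (Fin 2) k) L
  rw [trdeg_eq_zero (R := MvPolynomial (Fin 2) k), MvPolynomial.trdeg_of_isDomain] at h
  simpa using h.symm

lemma exists_aeval_div_eq {x c : L} (hc : c ∈ k⟮x⟯) :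
    ∃ r s : Polynomial k, Polynomial.aeval x s ≠ 0 ∧
      c = Polynomial.aeval x r / Polynomial.aeval x s := by
  obtain ⟨r, s, rfl⟩ := (mem_adjoin_simple_iff k c).mp hc
  by_cases hs : Polynomial.aeval x s = 0
  · exact ⟨0, 1, by simp, by simp [hs]⟩
  · exact ⟨r, s, hs, rfl⟩

lemma exists_aeval_mul_eq_aevalAeval {x t a : L} (ha : a ∈ Algebra.adjoin k⟮x⟯ {t}) :
    ∃ (s : Polynomial k) (Q : Polynomial (Polynomial k)),
      Polynomial.aeval x s ≠ 0 ∧ Polynomial.aeval x s * a = Polynomial.aevalAeval x t Q := by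
  induction ha using Algebra.adjoin_induction with
  | mem y hy =>
    obtain rfl := Set.mem_singleton_iff.mp hy
    exact ⟨1, Polynomial.X, by simp, by rw [Polynomial.aevalAeval_Y]; simp⟩
  | algebraMap c =>
    obtain ⟨r, s, hs, hc⟩ := exists_aeval_div_eq c.2
    refine ⟨s, Polynomial.C r, hs, ?_⟩
    rw [Polynomial.aevalAeval_C, IntermediateField.algebraMap_apply, hc, mul_div_cancel₀ _ hs]
  | add a b _ _ ha hb =>
    obtain ⟨s, Q, hs, hQ⟩ := ha
    obtain ⟨s', Q', hs', hQ'⟩ := hb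
    refine ⟨s * s', Polynomial.C s' * Q + Polynomial.C s * Q',
      by rw [map_mul]; exact mul_ne_zero hs hs', ?_⟩
    rw [map_mul, map_add, map_mul, map_mul, ← hQ, ← hQ', Polynomial.aevalAeval_C,
      Polynomial.aevalAeval_C]
    ring
  | mul a b _ _ ha hb =>
    obtain ⟨s, Q, hs, hQ⟩ := ha
    obtain ⟨s', Q', hs', hQ'⟩ := hb
    refine ⟨s * s', Q * Q', by rw [map_mul]; exact mul_ne_zero hs hs', ?_⟩
    rw [map_mul, map_mul, ← hQ, ← hQ']
    ring

lemma map_aevalAeval {E E' : Type*} [CommRing E] [CommRing E'] [Algebra k E] [Algebra k E']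
    (φ : E →ₐ[k] E') (x y : E) (Q : Polynomial (Polynomial k)) :
    φ (Polynomial.aevalAeval x y Q) = Polynomial.aevalAeval (φ x) (φ y) Q := by
  have : φ.comp (Polynomial.aevalAeval x y) = Polynomial.aevalAeval (φ x) (φ y) := by
    apply Polynomial.algHom_ext'
    · ext; simp
    · simp
  exact DFunLike.congr_fun this Q

end FieldGenerator

section Main

open IntermediateField SimpleTranscendental

variable {k L : Type*} [Field k] [Field L] [Algebra (MvPolynomial (Fin 2) k) L]
  [IsFractionRing (MvPolynomial (Fin 2) k) L] [Algebra k L]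
  [IsScalarTower k (MvPolynomial (Fin 2) k) L] {F : MvPolynomial (Fin 2) k}

local notation "ι" => algebraMap (MvPolynomial (Fin 2) k) L

lemma adjoin_algebraMap_eq_top {G : MvPolynomial (Fin 2) k}
    (h : Algebra.adjoin k ({F, G} : Set (MvPolynomial (Fin 2) k)) = ⊤) :
    IntermediateField.adjoin k {ι F, ι G} = ⊤ := by
  have key (a : MvPolynomial (Fin 2) k) : ι a ∈ IntermediateField.adjoin k {ι F, ι G} := by
    have ha : a ∈ Algebra.adjoin k ({F, G} : Set (MvPolynomial (Fin 2) k)) := by simp [h]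
    have := (Subalgebra.mem_map (f := IsScalarTower.toAlgHom k _ L)).mpr ⟨a, ha, rfl⟩
    rw [AlgHom.map_adjoin, Set.image_pair] at this
    exact IntermediateField.algebra_adjoin_le_adjoin k _ this
  refine eq_top_iff.mpr fun x _ ↦ ?_
  obtain ⟨a, b, -, rfl⟩ := IsFractionRing.div_surjective (MvPolynomial (Fin 2) k) x
  exact div_mem (key a) (key b)

omit [IsFractionRing (MvPolynomial (Fin 2) k) L] in
lemma algebraMap_mem_of_adjoin_eq_top {G : MvPolynomial (Fin 2) k}
    (h : Algebra.adjoin k ({F, G} : Set (MvPolynomial (Fin 2) k)) = ⊤) {R : ValuationSubring L}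
    (hR : ∀ c : k⟮ι F⟯, algebraMap _ L c ∈ R) (hG : ι G ∈ R) (a : MvPolynomial (Fin 2) k) :
    ι a ∈ R := by
  have ha : a ∈ Algebra.adjoin k ({F, G} : Set (MvPolynomial (Fin 2) k)) := by simp [h]
  induction ha using Algebra.adjoin_induction with
  | mem x hx =>
    rcases hx with rfl | rfl
    · exact hR ⟨_, mem_adjoin_simple_self k _⟩
    · exact hG
  | algebraMap c =>
    rw [← IsScalarTower.algebraMap_apply]
    exact hR (algebraMap k _ c)
  | add _ _ _ _ h1 h2 => rw [map_add]; exact add_mem h1 h2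
  | mul _ _ _ _ h1 h2 => rw [map_mul]; exact mul_mem h1 h2

theorem exists_adjoin_eq_top_of_hasUniquePole {g : L}
    (hFg : IntermediateField.adjoin k {ι F, g} = ⊤) {R₀ : ValuationSubring L}
    (hR₀ : ∀ c : k⟮ι F⟯, algebraMap _ L c ∈ R₀) (ha₀ : ∃ a, ι a ∉ R₀)
    (huniq : ∀ R : ValuationSubring L, (∀ c : k⟮ι F⟯, algebraMap _ L c ∈ R) →
      (∃ a, ι a ∉ R) → R = R₀) :
    ∃ G : MvPolynomial (Fin 2) k,
      Algebra.adjoin k ({F, G} : Set (MvPolynomial (Fin 2) k)) = ⊤ := by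
  have hind := algebraicIndependent_of_adjoin_eq_top trdeg_eq_two hFg
  have hιinj : Function.Injective ι := IsFractionRing.injective _ L
  have haev (p : Polynomial k) : Polynomial.aeval (ι F) p = ι (Polynomial.aeval F p) :=
    Polynomial.aeval_algebraMap_apply L F p
  have hFinj : Function.Injective (Polynomial.aeval (R := k) F) := by
    have ht : Transcendental k (ι F) := by simpa using hind.transcendental 0
    intro p q hpq
    exact transcendental_iff_injective.mp ht (by rw [haev, haev, hpq])
  let M : Submonoid (MvPolynomial (Fin 2) k) :=
    (nonZeroDivisors (Polynomial k)).map (Polynomial.aeval (R := k) F)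
  have hM : M ≤ nonZeroDivisors _ := map_le_nonZeroDivisors_of_injective _ hFinj le_rfl
  let B := Localization.subalgebra.ofField L M hM
  have : UniqueFactorizationMonoid B := UniqueFactorizationMonoid.of_isLocalization M B
  have : IsIntegrallyClosed B := inferInstance
  have : IsIntegrallyClosedIn B L := (isIntegrallyClosed_iff_isIntegrallyClosedIn L).mp this
  have hBmem {x : L} : x ∈ B.toSubring ↔ ∃ (s : Polynomial k) (a : MvPolynomial (Fin 2) k),
      s ≠ 0 ∧ x = ι a * (Polynomial.aeval (ι F) s)⁻¹ := by
    constructor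
    · rintro ⟨a, -, ⟨s, hs, rfl⟩, hx⟩
      exact ⟨s, a, nonZeroDivisors.ne_zero hs, by rw [hx, haev]⟩
    · rintro ⟨s, a, hs, hx⟩
      exact ⟨a, _, ⟨s, mem_nonZeroDivisors_of_ne_zero hs, rfl⟩, by rw [hx, haev]⟩
  have hιB (a) : ι a ∈ B.toSubring := hBmem.mpr ⟨1, a, one_ne_zero, by simp⟩
  have hinvK (s : Polynomial k) : (Polynomial.aeval (ι F) s)⁻¹ ∈ k⟮ι F⟯ :=
    inv_mem (IntermediateField.algebra_adjoin_le_adjoin k _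
      (Polynomial.aeval_mem_adjoin_singleton k _))
  have hB : HasUniquePole k⟮ι F⟯ B.toSubring R₀ := by
    refine ⟨fun c ↦ ?_, hR₀, fun hle ↦ ?_, fun R hR hne x hx ↦ ?_⟩
    · obtain ⟨r, s, hs, hc⟩ := exists_aeval_div_eq c.2
      refine hBmem.mpr ⟨s, Polynomial.aeval F r, fun h ↦ hs (by simp [h]), ?_⟩
      rw [← haev, IntermediateField.algebraMap_apply, hc, div_eq_mul_inv]
    · obtain ⟨a, ha⟩ := ha₀
      exact ha (hle (hιB a))
    · obtain ⟨s, a, -, rfl⟩ := hBmem.mp hx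
      refine mul_mem ?_ (hR ⟨_, hinvK s⟩)
      by_contra ha
      exact hne (huniq R hR ⟨a, ha⟩)
  have hufd : UniqueFactorizationMonoid B.toSubring := ‹UniqueFactorizationMonoid B›
  have hicl : IsIntegrallyClosedIn B.toSubring L := ‹IsIntegrallyClosedIn B L›
  obtain ⟨t₀, ht₀⟩ := hB.exists_eq_adjoin (adjoin_simple_adjoin_simple_eq_top hFg)
    hind.transcendental_adjoin_simple
  have ht₀B : t₀ ∈ B.toSubring := ht₀ ▸ Algebra.self_mem_adjoin_singleton _ t₀
  obtain ⟨s, t, -, hst⟩ := hBmem.mp ht₀B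
  have hle : Algebra.adjoin k⟮ι F⟯ {t₀} ≤ Algebra.adjoin k⟮ι F⟯ {ι t} := by
    rw [Algebra.adjoin_le_iff, Set.singleton_subset_iff, hst]
    exact mul_mem (Algebra.self_mem_adjoin_singleton _ _)
      (Subalgebra.algebraMap_mem _ (⟨_, hinvK s⟩ : k⟮ι F⟯))
  refine IsGenericCoordinate.exists_adjoin_eq_top (F := F) (t := t) fun a ↦ ?_
  have haB : ι a ∈ Algebra.adjoin k⟮ι F⟯ {t₀} := by
    have := hιB a
    rwa [ht₀] at this
  obtain ⟨s, Q, hs, hQ⟩ := exists_aeval_mul_eq_aevalAeval (hle haB)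
  rw [haev] at hs hQ
  refine ⟨s, Q, fun h ↦ hs (by simp [h]), hιinj ?_⟩
  rw [map_mul, hQ]
  exact (map_aevalAeval (IsScalarTower.toAlgHom k _ L) F t Q).symm

end Main

/-- A field generator `F` of `A = k[X,Y]` is a variable of `A`
if and only if the number `t` of dicriticals of `(F,A)` (valuation rings `R` of
`Frac(A)/k(F)` with `A ⊄ R`) equals `1`. -/
theorem stmt17 (k : Type) [Field k] (L : Type) [Field L]
    [Algebra (MvPolynomial (Fin 2) k) L] [IsFractionRing (MvPolynomial (Fin 2) k) L]
    [Algebra k L] [IsScalarTower k (MvPolynomial (Fin 2) k) L]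
    (F : MvPolynomial (Fin 2) k)
    (hFG : ∃ g : L, IntermediateField.adjoin k
        {algebraMap (MvPolynomial (Fin 2) k) L F, g} = ⊤) :
    (∃ G : MvPolynomial (Fin 2) k,
        Algebra.adjoin k ({F, G} : Set (MvPolynomial (Fin 2) k)) = ⊤)
    ↔ ∃ R₀ : ValuationSubring L,
        {R : ValuationSubring L |
          ((Subfield.closure (Set.range (algebraMap k L)
              ∪ {algebraMap (MvPolynomial (Fin 2) k) L F}) : Subfield L) : Set L) ⊆ (R : Set L) ∧
          R ≠ ⊤ ∧
          ∃ a : MvPolynomial (Fin 2) k, algebraMap (MvPolynomial (Fin 2) k) L a ∉ R}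
        = {R₀} := by
  have hsub (R : ValuationSubring L) : ((Subfield.closure (Set.range (algebraMap k L)
      ∪ {algebraMap (MvPolynomial (Fin 2) k) L F}) : Subfield L) : Set L) ⊆ (R : Set L) ↔
      ∀ c : IntermediateField.adjoin k {algebraMap (MvPolynomial (Fin 2) k) L F},
        algebraMap _ L c ∈ R := ⟨fun h c ↦ h c.2, fun h x hx ↦ h ⟨x, hx⟩⟩
  simp only [hsub]
  constructor
  · rintro ⟨G, hG⟩
    have htop := adjoin_algebraMap_eq_top (L := L) hG
    have ht := (algebraicIndependent_of_adjoin_eq_top trdeg_eq_two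
      htop).transcendental_adjoin_simple
    obtain ⟨R₀, hR₀, hGR₀⟩ := SimpleTranscendental.exists_notMem ht
    refine ⟨R₀, Set.ext fun R ↦ ⟨fun ⟨hR, _, a, ha⟩ ↦ ?_, ?_⟩⟩
    · exact SimpleTranscendental.eq_of_notMem (adjoin_simple_adjoin_simple_eq_top htop) ht hR hR₀
        (fun hGR ↦ ha (algebraMap_mem_of_adjoin_eq_top hG hR hGR a)) hGR₀
    · rintro rfl
      exact ⟨hR₀, fun h ↦ hGR₀ (h ▸ ValuationSubring.mem_top _), G, hGR₀⟩
  · rintro ⟨R₀, hR₀⟩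
    obtain ⟨g, hg⟩ := hFG
    have hmem := hR₀.ge (Set.mem_singleton R₀)
    refine exists_adjoin_eq_top_of_hasUniquePole hg hmem.1 hmem.2.2 fun R hR ⟨a, ha⟩ ↦ ?_
    exact hR₀.le ⟨hR, fun h ↦ ha (h ▸ ValuationSubring.mem_top _), a, ha⟩
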